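/- (AA similarity, rule D58.) Let A, B, C and P, Q, R be points of the Euclidean plane with A, B, C not collinear and P, Q, R not collinear, and suppose ∠ B A C = ∠ Q P R and ∠ A B C = ∠ P Q R. Then the triangles ABC and PQR are similar: the corresponding sides are proportional, i.e., dist A B * dist Q R = dist P Q * dist B C and dist A B * dist P R = dist P Q * dist A C. -/

import Mathlib

open EuclideanGeometry

theorem aa_similarity
    (A B C P Q R : EuclideanSpace ℝ (Fin 2))
    (hncol₁ : ¬ Collinear ℝ ({A, B, C} : Set (EuclideanSpace ℝ (Fin 2))))
    (hncol₂ : ¬ Collinear ℝ ({P, Q, R} : Set (EuclideanSpace ℝ (Fin 2))))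
    (hA : ∠ B A C = ∠ Q P R) (hB : ∠ A B C = ∠ P Q R) :
    dist A B * dist Q R = dist P Q * dist B C ∧
    dist A B * dist P R = dist P Q * dist A C := by
  have hCAB : ¬ Collinear ℝ ({C, A, B} : Set (EuclideanSpace ℝ (Fin 2))) := by
    rwa [Set.insert_comm, Set.pair_comm]
  have hsim : Similar ![C, A, B] ![R, P, Q] :=
    similar_of_angle_angle hCAB (by rwa [angle_comm C, angle_comm R]) hB
  obtain ⟨r, -, hdist⟩ := similar_iff_exists_pos_dist_eq.1 hsim
  have hAB : dist A B = r * dist P Q := hdist 1 2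
  have hBC : dist B C = r * dist Q R := hdist 2 0
  have hAC : dist A C = r * dist P R := hdist 1 0
  rw [hAB, hBC, hAC]
  constructor <;> ring
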